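/- Suppose that for every y0 ∈ Y the limit h(y0) := lim_{ε→0} h_ε(y0) exists (i.e., h_ε converges pointwise on Y to a function h as ε → 0) and the limit function h is continuous on Y. Then h(y0) = d*(y0) for every y0 ∈ Y. -/

import Mathlib

open MeasureTheory Filter Set Topology
open scoped ENNReal NNReal

noncomputable section

namespace StochLP

/-- The model of the controlled stochastic discrete time system (controlled stochastic
recursion) `y(t+1) = f(y(t), u(t), s(t))` from the paper: `Y ⊂ ℝⁿ` is a compact forward
invariant state constraint set, `Uc` is a compact metric control space, `S` is a Polish
noise space, `U` is an upper semicontinuous compact valued control constraint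
multifunction (upper semicontinuity of a compact valued map into a compact space being
recorded as closedness of its graph), `f` is bounded, continuous in `(y,u)` and Borel
measurable in `s`, and `ν` is the common law of the i.i.d. noise elements `s(t)`. -/
structure Model (n : ℕ) (Uc S : Type) [MetricSpace Uc] [CompactSpace Uc]
    [MeasurableSpace Uc] [BorelSpace Uc] [TopologicalSpace S] [PolishSpace S]
    [MeasurableSpace S] [BorelSpace S] where
  Y : Set (Fin n → ℝ)
  U : (Fin n → ℝ) → Set Uc
  f : (Fin n → ℝ) → Uc → S → (Fin n → ℝ)
  ν : Measure S
  ν_prob : IsProbabilityMeasure ν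
  Y_compact : IsCompact Y
  Y_nonempty : Y.Nonempty
  U_nonempty : ∀ y ∈ Y, (U y).Nonempty
  U_compact : ∀ y ∈ Y, IsCompact (U y)
  graph_closed : IsClosed {p : (Fin n → ℝ) × Uc | p.1 ∈ Y ∧ p.2 ∈ U p.1}
  f_bounded : ∃ C : ℝ, ∀ y ∈ Y, ∀ (u : Uc) (s : S), ‖f y u s‖ ≤ C
  f_cont : ∀ s : S, ContinuousOn (fun p : (Fin n → ℝ) × Uc => f p.1 p.2 s) (Y ×ˢ univ)
  f_meas : ∀ y ∈ Y, ∀ u : Uc, Measurable fun s => f y u s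
  f_inv : ∀ y ∈ Y, ∀ u ∈ U y, ∀ s : S, f y u s ∈ Y

variable {n : ℕ} {Uc S : Type} [MetricSpace Uc] [CompactSpace Uc] [MeasurableSpace Uc]
  [BorelSpace Uc] [TopologicalSpace S] [PolishSpace S] [MeasurableSpace S] [BorelSpace S]

/-- A control plan: a sequence of Borel measurable selections of the multifunction `U`. -/
structure Plan (M : Model n Uc S) where
  π : ℕ → (Fin n → ℝ) → Uc
  measurable : ∀ t, Measurable (π t)
  feasible : ∀ t, ∀ y ∈ M.Y, π t y ∈ M.U y

/-- The law of the state `y^{π,y₀}(t)` of the controlled stochastic recursion started at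
`y₀` and driven by the i.i.d. noise with common law `ν`, defined by the Markov recursion.  -/
def stateLaw (M : Model n Uc S) (t : ℕ) :
    (ℕ → (Fin n → ℝ) → Uc) → (Fin n → ℝ) → Measure (Fin n → ℝ) :=
  Nat.rec (motive := fun _ => (ℕ → (Fin n → ℝ) → Uc) → (Fin n → ℝ) → Measure (Fin n → ℝ))
    (fun _ y => Measure.dirac y)
    (fun _ ih π y =>
      (M.ν.map fun s => M.f y (π 0 y) s).bind fun y' => ih (fun j => π (j + 1)) y') t

/-- The joint law of the state-control pair `(y^{π,y₀}(t), u^{π,y₀}(t))`. -/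
def saLaw (M : Model n Uc S) (t : ℕ) (π : ℕ → (Fin n → ℝ) → Uc) (y0 : Fin n → ℝ) :
    Measure ((Fin n → ℝ) × Uc) :=
  (stateLaw M t π y0).map fun z => (z, π t z)

/-- `E[q(y^{π,y₀}(t), u^{π,y₀}(t))]`. -/
def expSA (M : Model n Uc S) (t : ℕ) (π : ℕ → (Fin n → ℝ) → Uc) (y0 : Fin n → ℝ)
    (q : (Fin n → ℝ) → Uc → ℝ) : ℝ :=
  ∫ p, q p.1 p.2 ∂saLaw M t π y0

/-- The finite horizon average expected cost `(1/T) E[Σ_{t=0}^{T-1} k(y(t),u(t))]`. -/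
def costT (M : Model n Uc S) (k : (Fin n → ℝ) → Uc → ℝ) (T : ℕ) (π : ℕ → (Fin n → ℝ) → Uc)
    (y0 : Fin n → ℝ) : ℝ :=
  (1 / (T : ℝ)) * ∑ t ∈ Finset.range T, expSA M t π y0 k

/-- The optimal value `v_T(y₀)` of the finite horizon problem. -/
def vT (M : Model n Uc S) (k : (Fin n → ℝ) → Uc → ℝ) (T : ℕ) (y0 : Fin n → ℝ) : ℝ :=
  ⨅ π : Plan M, costT M k T π.π y0

/-- The expected discounted cost `ε Σ_{t=0}^∞ (1-ε)^t E[k(y(t),u(t))]`. -/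
def costDisc (M : Model n Uc S) (k : (Fin n → ℝ) → Uc → ℝ) (ε : ℝ)
    (π : ℕ → (Fin n → ℝ) → Uc) (y0 : Fin n → ℝ) : ℝ :=
  ε * ∑' t : ℕ, (1 - ε) ^ t * expSA M t π y0 k

/-- The optimal value `h_ε(y₀)` of the discounted problem. -/
def hEps (M : Model n Uc S) (k : (Fin n → ℝ) → Uc → ℝ) (ε : ℝ) (y0 : Fin n → ℝ) : ℝ :=
  ⨅ π : Plan M, costDisc M k ε π.π y0

/-- The graph `G` of the multifunction `U`. -/
def graphG (M : Model n Uc S) : Set ((Fin n → ℝ) × Uc) := {p | p.1 ∈ M.Y ∧ p.2 ∈ M.U p.1}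

/-- `E[φ(f(y,u,s))]`, the expectation over the noise of `φ` evaluated after one step. -/
def Ef (M : Model n Uc S) (φ : (Fin n → ℝ) → ℝ) (y : Fin n → ℝ) (u : Uc) : ℝ :=
  ∫ s, φ (M.f y u s) ∂M.ν

/-- A measure on `Y × Uc` is concentrated on the graph `G` (this encodes measures defined
on Borel subsets of `G`). -/
def onG (M : Model n Uc S) (γ : Measure ((Fin n → ℝ) × Uc)) : Prop := γ (graphG M)ᶜ = 0

/-- The set `W` of stationary measures. -/
def Wset (M : Model n Uc S) : Set (Measure ((Fin n → ℝ) × Uc)) :=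
  {γ | IsProbabilityMeasure γ ∧ onG M γ ∧
    ∀ φ : (Fin n → ℝ) → ℝ, Continuous φ → ∫ p, (Ef M φ p.1 p.2 - φ p.1) ∂γ = 0}

/-- The set `W(ε, y₀)` of discounted stationary measures. -/
def Weps (M : Model n Uc S) (ε : ℝ) (y0 : Fin n → ℝ) : Set (Measure ((Fin n → ℝ) × Uc)) :=
  {γ | IsProbabilityMeasure γ ∧ onG M γ ∧
    ∀ φ : (Fin n → ℝ) → ℝ, Continuous φ →
      ∫ p, ((1 - ε) * (Ef M φ p.1 p.2 - φ p.1) + ε * (φ y0 - φ p.1)) ∂γ = 0}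

/-- The optimal value `k*(ε, y₀)` of the IDLP problem over `W(ε, y₀)`. -/
def kStarEps (M : Model n Uc S) (k : (Fin n → ℝ) → Uc → ℝ) (ε : ℝ) (y0 : Fin n → ℝ) : ℝ :=
  sInf ((fun γ : Measure ((Fin n → ℝ) × Uc) => ∫ p, k p.1 p.2 ∂γ) '' Weps M ε y0)

/-- The optimal value `k*` of the IDLP problem over `W`. -/
def kStar (M : Model n Uc S) (k : (Fin n → ℝ) → Uc → ℝ) : ℝ :=
  sInf ((fun γ : Measure ((Fin n → ℝ) × Uc) => ∫ p, k p.1 p.2 ∂γ) '' Wset M)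

/-- The optimal value `μ*(ε, y₀)` of the problem dual to the IDLP problem over `W(ε,y₀)`. -/
def muStarEps (M : Model n Uc S) (k : (Fin n → ℝ) → Uc → ℝ) (ε : ℝ) (y0 : Fin n → ℝ) : ℝ :=
  sSup {r : ℝ | ∃ ψ : (Fin n → ℝ) → ℝ, Continuous ψ ∧
    r = sInf ((fun p : (Fin n → ℝ) × Uc =>
      k p.1 p.2 + (1 - ε) * (Ef M ψ p.1 p.2 - ψ p.1) + ε * (ψ y0 - ψ p.1)) '' graphG M)}

/-- The optimal value `μ*` of the problem dual to the IDLP problem over `W`. -/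
def muStar (M : Model n Uc S) (k : (Fin n → ℝ) → Uc → ℝ) : ℝ :=
  sSup {r : ℝ | ∃ ψ : (Fin n → ℝ) → ℝ, Continuous ψ ∧
    r = sInf ((fun p : (Fin n → ℝ) × Uc => k p.1 p.2 + Ef M ψ p.1 p.2 - ψ p.1) '' graphG M)}

/-- The feasible set `Ω(y₀)` of the augmented IDLP problem. -/
def OmegaSet (M : Model n Uc S) (y0 : Fin n → ℝ) :
    Set (Measure ((Fin n → ℝ) × Uc) × Measure ((Fin n → ℝ) × Uc)) :=
  {p | p.1 ∈ Wset M ∧ IsFiniteMeasure p.2 ∧ onG M p.2 ∧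
    ∀ φ : (Fin n → ℝ) → ℝ, Continuous φ →
      ∫ q, (φ y0 - φ q.1) ∂p.1 + ∫ q, (Ef M φ q.1 q.2 - φ q.1) ∂p.2 = 0}

/-- The optimal value `k*(y₀)` of the augmented IDLP problem. -/
def kStarAug (M : Model n Uc S) (k : (Fin n → ℝ) → Uc → ℝ) (y0 : Fin n → ℝ) : ℝ :=
  sInf ((fun p : Measure ((Fin n → ℝ) × Uc) × Measure ((Fin n → ℝ) × Uc) =>
    ∫ q, k q.1 q.2 ∂p.1) '' OmegaSet M y0)

/-- Feasibility of `(μ, ψ, η)` for the problem dual to the augmented IDLP problem. -/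
def DualFeas (M : Model n Uc S) (k : (Fin n → ℝ) → Uc → ℝ) (y0 : Fin n → ℝ)
    (ψ η : (Fin n → ℝ) → ℝ) (μ : ℝ) : Prop :=
  (∀ p ∈ graphG M, 0 ≤ k p.1 p.2 + (ψ y0 - ψ p.1) + Ef M η p.1 p.2 - η p.1 - μ) ∧
  (∀ p ∈ graphG M, 0 ≤ Ef M ψ p.1 p.2 - ψ p.1)

/-- The optimal value `d*(y₀)` of the dual (with continuous test functions) of the
augmented IDLP problem. -/
def dStar (M : Model n Uc S) (k : (Fin n → ℝ) → Uc → ℝ) (y0 : Fin n → ℝ) : ℝ :=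
  sSup {μ : ℝ | ∃ ψ η : (Fin n → ℝ) → ℝ, Continuous ψ ∧ Continuous η ∧
    DualFeas M k y0 ψ η μ}

/-- Bounded Borel measurable real valued functions. -/
def BddBorel (ψ : (Fin n → ℝ) → ℝ) : Prop := Measurable ψ ∧ ∃ C : ℝ, ∀ y, |ψ y| ≤ C

/-- The optimal value `d̂*(y₀)` of the relaxed dual (with bounded Borel test functions) of
the augmented IDLP problem. -/
def dHatStar (M : Model n Uc S) (k : (Fin n → ℝ) → Uc → ℝ) (y0 : Fin n → ℝ) : ℝ :=
  sSup {μ : ℝ | ∃ ψ η : (Fin n → ℝ) → ℝ, BddBorel ψ ∧ BddBorel η ∧ DualFeas M k y0 ψ η μ}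

/-- The occupational measure `γ^{π,y₀,T}`. -/
def occT (M : Model n Uc S) (T : ℕ) (π : ℕ → (Fin n → ℝ) → Uc) (y0 : Fin n → ℝ) :
    Measure ((Fin n → ℝ) × Uc) :=
  (T : ℝ≥0∞)⁻¹ • ∑ t ∈ Finset.range T, saLaw M t π y0

/-- The discounted occupational measure `γ_d^{π,y₀,ε}`. -/
def discOcc (M : Model n Uc S) (ε : ℝ) (π : ℕ → (Fin n → ℝ) → Uc) (y0 : Fin n → ℝ) :
    Measure ((Fin n → ℝ) × Uc) :=
  ENNReal.ofReal ε • Measure.sum fun t : ℕ => ENNReal.ofReal (1 - ε) ^ t • saLaw M t π y0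

/-- The set `Θ_ε(y₀)` of discounted occupational measures, as a set of probability
measures (carrying the topology of weak convergence). -/
def ThetaEps (M : Model n Uc S) (ε : ℝ) (y0 : Fin n → ℝ) :
    Set (ProbabilityMeasure ((Fin n → ℝ) × Uc)) :=
  {μ | ∃ π : Plan M, μ.toMeasure = discOcc M ε π.π y0}

/-- `Θ_ε := ∪_{y₀ ∈ Y} Θ_ε(y₀)`. -/
def ThetaEpsAll (M : Model n Uc S) (ε : ℝ) : Set (ProbabilityMeasure ((Fin n → ℝ) × Uc)) :=
  ⋃ y0 ∈ M.Y, ThetaEps M ε y0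

/-- The set `Γ_T(y₀)` of occupational measures. -/
def GammaT (M : Model n Uc S) (T : ℕ) (y0 : Fin n → ℝ) :
    Set (ProbabilityMeasure ((Fin n → ℝ) × Uc)) :=
  {μ | ∃ π : Plan M, μ.toMeasure = occT M T π.π y0}

/-- `Γ_T := ∪_{y₀ ∈ Y} Γ_T(y₀)`. -/
def GammaTAll (M : Model n Uc S) (T : ℕ) : Set (ProbabilityMeasure ((Fin n → ℝ) × Uc)) :=
  ⋃ y0 ∈ M.Y, GammaT M T y0

/-- `W` as a set of probability measures. -/
def WsetPM (M : Model n Uc S) : Set (ProbabilityMeasure ((Fin n → ℝ) × Uc)) :=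
  {μ | μ.toMeasure ∈ Wset M}

/-- `W(ε,y₀)` as a set of probability measures. -/
def WepsPM (M : Model n Uc S) (ε : ℝ) (y0 : Fin n → ℝ) :
    Set (ProbabilityMeasure ((Fin n → ℝ) × Uc)) :=
  {μ | μ.toMeasure ∈ Weps M ε y0}

/-- The set of finite convex combinations of elements of a set of probability measures,
i.e. its convex hull. -/
def convexCombos {α : Type*} [MeasurableSpace α] (A : Set (ProbabilityMeasure α)) :
    Set (ProbabilityMeasure α) :=
  {μ | ∃ (m : ℕ) (w : Fin m → ℝ≥0) (γ : Fin m → ProbabilityMeasure α),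
    (∀ i, γ i ∈ A) ∧ (∑ i, w i) = 1 ∧
    μ.toMeasure = ∑ i, (w i : ℝ≥0∞) • (γ i).toMeasure}

/-- Membership in the set `D₁(y₀)`. -/
def D1mem (M : Model n Uc S) (y0 : Fin n → ℝ) (γ : Measure ((Fin n → ℝ) × Uc)) : Prop :=
  ∃ ξ : ℕ → Measure ((Fin n → ℝ) × Uc),
    (∀ l, IsFiniteMeasure (ξ l) ∧ onG M (ξ l)) ∧
    ∀ φ : (Fin n → ℝ) → ℝ, Continuous φ →
      Tendsto (fun l => ∫ q, (Ef M φ q.1 q.2 - φ q.1) ∂ξ l) atTop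
        (𝓝 (∫ q, (φ q.1 - φ y0) ∂γ))

/-- A control plan is periodic regime generating (PRG) for the initial point `y₀`. -/
def IsPRG (M : Model n Uc S) (π : Plan M) (y0 : Fin n → ℝ) : Prop :=
  ∃ T0 Tp : ℕ, 0 < Tp ∧
    ∀ q : ((Fin n → ℝ) × Uc) → ℝ, Continuous q →
      ∀ t, T0 ≤ t → ∫ p, q p ∂saLaw M t π.π y0 = ∫ p, q p ∂saLaw M (t + Tp) π.π y0

/-- The optimal value `V_per(y₀)` over periodic regime generating control plans. -/
def Vper (M : Model n Uc S) (k : (Fin n → ℝ) → Uc → ℝ) (y0 : Fin n → ℝ) : ℝ :=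
  sInf {c : ℝ | ∃ π : Plan M, IsPRG M π y0 ∧
    Tendsto (fun T => costT M k T π.π y0) atTop (𝓝 c)}

/-- The optimal value `k*_θ(y₀)` of the perturbed augmented IDLP problem. -/
def kStarTheta (M : Model n Uc S) (k θ : (Fin n → ℝ) → Uc → ℝ) (y0 : Fin n → ℝ) : ℝ :=
  sInf ((fun p : Measure ((Fin n → ℝ) × Uc) × Measure ((Fin n → ℝ) × Uc) =>
    ∫ q, k q.1 q.2 ∂p.1 + ∫ q, θ q.1 q.2 ∂p.2) '' OmegaSet M y0)

/-- Feasibility of `(μ, ψ, η)` for the perturbed dual problem. -/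
def DualFeasTheta (M : Model n Uc S) (k θ : (Fin n → ℝ) → Uc → ℝ) (y0 : Fin n → ℝ)
    (ψ η : (Fin n → ℝ) → ℝ) (μ : ℝ) : Prop :=
  (∀ p ∈ graphG M, 0 ≤ k p.1 p.2 + (ψ y0 - ψ p.1) + Ef M η p.1 p.2 - η p.1 - μ) ∧
  (∀ p ∈ graphG M, -θ p.1 p.2 ≤ Ef M ψ p.1 p.2 - ψ p.1)

/-- The optimal value `d*_θ(y₀)` of the perturbed dual problem. -/
def dStarTheta (M : Model n Uc S) (k θ : (Fin n → ℝ) → Uc → ℝ) (y0 : Fin n → ℝ) : ℝ :=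
  sSup {μ : ℝ | ∃ ψ η : (Fin n → ℝ) → ℝ, Continuous ψ ∧ Continuous η ∧
    DualFeasTheta M k θ y0 ψ η μ}

/-- The optimal value `d̄*_θ(y₀)` of the second form of the perturbed dual problem. -/
def dBarTheta (M : Model n Uc S) (k θ : (Fin n → ℝ) → Uc → ℝ) (y0 : Fin n → ℝ) : ℝ :=
  sSup {r : ℝ | ∃ ψ η : (Fin n → ℝ) → ℝ, Continuous ψ ∧ Continuous η ∧ r = ψ y0 ∧
    (∀ p ∈ graphG M, 0 ≤ k p.1 p.2 - ψ p.1 + Ef M η p.1 p.2 - η p.1) ∧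
    (∀ p ∈ graphG M, -θ p.1 p.2 ≤ Ef M ψ p.1 p.2 - ψ p.1)}

/-- Measurable selection of minimizers along the fibres of a continuous surjection from a compact
metric space. The value function is lower semicontinuous. -/
theorem exists_measurable_fiberwise_argmin {X G : Type*} [TopologicalSpace X] [T2Space X]
    [MeasurableSpace X] [BorelSpace X] [MetricSpace G] [CompactSpace G] [Nonempty G]
    [MeasurableSpace G] [BorelSpace G] {pr : G → X} (hpr : Continuous pr)
    (hsurj : Function.Surjective pr) {F : G → ℝ} (hF : LowerSemicontinuous F) :
    ∃ σ : X → G, Measurable σ ∧ (∀ x, pr (σ x) = x) ∧ (∀ g, F (σ (pr g)) ≤ F g) ∧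
      LowerSemicontinuous fun x => F (σ x) := by
  obtain ⟨c', hc', hc's⟩ := exists_nat_bool_continuous_surjective_of_compact G
  let c : cantorSet → G := fun t => c' (cantorSetHomeomorphNatToBool t)
  have hc : Continuous c := hc'.comp cantorSetHomeomorphNatToBool.continuous
  have hcs : Function.Surjective c := hc's.comp cantorSetHomeomorphNatToBool.surjective
  have : CompactSpace cantorSet := isCompact_iff_compactSpace.mp isCompact_cantorSet
  have hpc : Continuous fun t => pr (c t) := hpr.comp hc
  have hFc : LowerSemicontinuous fun t => F (c t) := hF.comp hc
  have hfib : ∀ x, IsClosed {t | pr (c t) = x} := fun x => isClosed_singleton.preimage hpc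
  have hmin : ∀ x, ∃ t, pr (c t) = x ∧ ∀ t', pr (c t') = x → F (c t) ≤ F (c t') := by
    intro x
    obtain ⟨g, hg⟩ := hsurj x
    obtain ⟨t, ht⟩ := hcs g
    obtain ⟨a, ha, hm⟩ := LowerSemicontinuousOn.exists_isMinOn (f := fun t => F (c t))
      (s := {t | pr (c t) = x}) ⟨t, by simp [ht, hg]⟩ (hfib x).isCompact
      (hFc.lowerSemicontinuousOn _)
    exact ⟨a, ha, fun t' ht' => hm ht'⟩
  choose t0 ht0 hmin0 using hmin
  have hm : LowerSemicontinuous fun x => F (c (t0 x)) := by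
    rw [lowerSemicontinuous_iff_isClosed_preimage]
    intro a
    have : (fun x => F (c (t0 x))) ⁻¹' Iic a = (fun t => pr (c t)) '' {t | F (c t) ≤ a} := by
      ext x
      simp only [mem_preimage, mem_Iic, mem_image, mem_ofPred_eq]
      exact ⟨fun hx => ⟨t0 x, hx, ht0 x⟩, fun ⟨t, h1, h2⟩ => (hmin0 x t h2).trans h1⟩
    rw [this]
    exact ((hFc.isClosed_preimage a).isCompact.image hpc).isClosed
  have hleast : ∀ x, ∃ t, IsLeast {t | pr (c t) = x ∧ F (c t) ≤ F (c (t0 x))} t := fun x =>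
    ((hfib x).inter (hFc.isClosed_preimage _)).isCompact.exists_isLeast
      ⟨t0 x, ht0 x, (le_rfl : F (c (t0 x)) ≤ F (c (t0 x)))⟩
  choose τ hτ using hleast
  have hval : ∀ x, F (c (τ x)) = F (c (t0 x)) := fun x =>
    le_antisymm (hτ x).1.2 (hmin0 x _ (hτ x).1.1)
  have hτm : Measurable fun x => (τ x : ℝ) := by
    refine measurable_of_Iic fun a => ?_
    have : (fun x => (τ x : ℝ)) ⁻¹' Iic a = ⋂ q : ℚ, ({x | F (c (t0 x)) < q}ᶜ ∪
        (fun t => pr (c t)) '' {t | (t : ℝ) ≤ a ∧ F (c t) ≤ q}) := by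
      ext x
      simp only [mem_preimage, mem_Iic, mem_iInter, mem_union, mem_compl_iff, mem_ofPred_eq,
        mem_image]
      constructor
      · intro hx q
        by_cases hq : F (c (t0 x)) < q
        · exact Or.inr ⟨τ x, ⟨hx, (hτ x).1.2.trans hq.le⟩, (hτ x).1.1⟩
        · exact Or.inl hq
      · intro hx
        obtain ⟨q, hq⟩ := exists_rat_gt (F (c (t0 x)))
        obtain ⟨t, ⟨hta, -⟩, ht⟩ := (hx q).resolve_left (not_not.2 hq)
        obtain ⟨b, hb, hbm⟩ := LowerSemicontinuousOn.exists_isMinOn (f := fun t => F (c t))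
          (s := {t | pr (c t) = x} ∩ {t : cantorSet | (t : ℝ) ≤ a}) ⟨t, ht, hta⟩
          ((hfib x).inter (isClosed_Iic.preimage continuous_subtype_val)).isCompact
          (hFc.lowerSemicontinuousOn _)
        have hb' : F (c b) ≤ F (c (t0 x)) := by
          refine le_of_forall_rat_lt_imp_le fun r hr => ?_
          by_contra! hcon
          obtain ⟨t, ⟨hta, htr⟩, ht⟩ := (hx r).resolve_left (not_not.2 hcon)
          exact (hr.trans_le ((hbm ⟨ht, hta⟩).trans htr)).false
        exact (Subtype.coe_le_coe.2 ((hτ x).2 ⟨hb.1, hb'⟩)).trans hb.2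
    rw [this]
    refine MeasurableSet.iInter fun q => ?_
    refine (measurableSet_lt hm.measurable measurable_const).compl.union ?_
    exact (((isClosed_Iic.preimage continuous_subtype_val).inter
      (hFc.isClosed_preimage _)).isCompact.image hpc).isClosed.measurableSet
  refine ⟨fun x => c (τ x), hc.measurable.comp (Measurable.subtype_mk hτm),
    fun x => (hτ x).1.1, fun g => ?_, by simpa only [hval] using hm⟩
  obtain ⟨t, rfl⟩ := hcs g
  rw [hval]
  exact hmin0 _ t rfl

/-- Fatou's lemma in the form: averaging a bounded lower semicontinuous function along a
Carathéodory map yields a lower semicontinuous function. -/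
theorem lowerSemicontinuous_integral_comp {G Z Ω : Type*} [TopologicalSpace G]
    [FirstCountableTopology G] [TopologicalSpace Z] [MeasurableSpace Z] [OpensMeasurableSpace Z]
    [MeasurableSpace Ω] {ν : Measure Ω} [IsProbabilityMeasure ν] {g : G → Ω → Z}
    (hg : ∀ s, Continuous fun p => g p s) (hgm : ∀ p, Measurable (g p)) {v : Z → ℝ}
    (hv : LowerSemicontinuous v) {D : ℝ} (hD : ∀ z, |v z| ≤ D) :
    LowerSemicontinuous fun p => ∫ s, v (g p s) ∂ν := by
  have hvi : ∀ p, Integrable (fun s => v (g p s)) ν := fun p =>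
    Integrable.of_bound (hv.measurable.comp (hgm p)).aestronglyMeasurable D
      (ae_of_all _ fun s => hD _)
  have hpos : ∀ z, 0 ≤ v z + D := fun z => by linarith [neg_le_of_abs_le (hD z)]
  have key : LowerSemicontinuous fun p => ∫⁻ s, ENNReal.ofReal (v (g p s) + D) ∂ν := by
    rw [lowerSemicontinuous_iff_le_liminf]
    intro p
    refine le_trans ?_ (lintegral_liminf_le fun p' =>
      ENNReal.measurable_ofReal.comp (((hv.measurable.comp (hgm p'))).add_const D))
    refine lintegral_mono fun s => ?_
    have h1 : LowerSemicontinuous fun p => ENNReal.ofReal (v (g p s) + D) := by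
      have := ((ENNReal.continuous_ofReal.comp (continuous_add_const D)).comp_lowerSemicontinuous
        (hv.comp (hg s)) fun a b hab => ENNReal.ofReal_le_ofReal (by simpa using hab))
      exact this
    exact lowerSemicontinuous_iff_le_liminf.1 h1 p
  have heq : ∀ p, ∫⁻ s, ENNReal.ofReal (v (g p s) + D) ∂ν =
      ENNReal.ofReal ((∫ s, v (g p s) ∂ν) + D) := fun p => by
    have h1 : Integrable (fun s => v (g p s) + D) ν := (hvi p).add (integrable_const D)
    rw [← ofReal_integral_eq_lintegral_ofReal h1 (ae_of_all _ fun s => hpos _),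
      integral_add (hvi p) (integrable_const D)]
    simp
  have hpos' : ∀ p, 0 ≤ (∫ s, v (g p s) ∂ν) + D := fun p => by
    have : 0 ≤ ∫ s, (v (g p s) + D) ∂ν := integral_nonneg fun s => hpos (g p s)
    rw [integral_add (hvi p) (integrable_const D)] at this
    simpa using this
  intro p a ha
  rcases lt_or_ge (a + D) 0 with h0 | h0
  · exact Eventually.of_forall fun p' => by linarith [hpos' p']
  · have h1 : ENNReal.ofReal (a + D) < ∫⁻ s, ENNReal.ofReal (v (g p s) + D) ∂ν := by
      rw [heq]
      exact (ENNReal.ofReal_lt_ofReal_iff (by linarith)).2 (by linarith)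
    filter_upwards [key p _ h1] with p' hp'
    rw [heq] at hp'
    linarith [(ENNReal.ofReal_lt_ofReal_iff_of_nonneg h0).1 hp']

theorem integral_bind_of_bounded {Z W : Type*} [MeasurableSpace Z] [MeasurableSpace W]
    {m : Measure Z} [IsFiniteMeasure m] {κ : Z → Measure W} (hκ : Measurable κ)
    (hprob : ∀ z, IsProbabilityMeasure (κ z)) {g : W → ℝ} (hg : Measurable g) {D : ℝ}
    (hD : ∀ w, |g w| ≤ D) : ∫ w, g w ∂(m.bind κ) = ∫ z, ∫ w, g w ∂(κ z) ∂m := by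
  let K : ProbabilityTheory.Kernel Z W := ⟨κ, hκ⟩
  have : ProbabilityTheory.IsMarkovKernel K := ⟨hprob⟩
  have h := ProbabilityTheory.Kernel.integral_comp (η := K)
    (κ := ProbabilityTheory.Kernel.const Unit m) (a := ()) (f := g)
    (Integrable.of_bound hg.aestronglyMeasurable D (ae_of_all _ hD))
  simpa [ProbabilityTheory.Kernel.comp_apply, K] using h

/-- A theorem of the alternative for a linear family of continuous functions on a compact space:
if every finite measure annihilating the family integrates `q` to a nonnegative number, then `q`
plus some member of the family is bounded below by `-δ`. -/
theorem exists_forall_neg_lt_add {G V : Type*} [TopologicalSpace G] [CompactSpace G] [T2Space G]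
    [Nonempty G] [MeasurableSpace G] [BorelSpace G] [AddCommGroup V] [Module ℝ V] (q : C(G, ℝ))
    (L : V →ₗ[ℝ] C(G, ℝ)) {δ : ℝ} (hδ : 0 < δ)
    (H : ∀ μ : Measure G, IsFiniteMeasure μ → (∀ v, ∫ p, L v p ∂μ = 0) → 0 ≤ ∫ p, q p ∂μ) :
    ∃ v, ∀ p, -δ < q p + L v p := by
  by_contra! hcon
  let P : Set C(G, ℝ) := {g | ∀ p, 0 < g p}
  let A : Set C(G, ℝ) := range fun v => q + ContinuousMap.const G δ + L v
  have hPo : IsOpen P := by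
    have := ContinuousMap.isOpen_setOfPred_mapsTo (X := G) (Y := ℝ) isCompact_univ
      (isOpen_Ioi (a := (0 : ℝ)))
    convert! this using 1
    ext g
    simp [P, MapsTo]
  have hPc : Convex ℝ P := by
    intro a ha b hb s t hs ht hst p
    have h1 := ha p
    have h2 := hb p
    simp only [ContinuousMap.add_apply, ContinuousMap.smul_apply, smul_eq_mul]
    rcases hs.eq_or_lt with rfl | hs'
    · have : t = 1 := by linarith
      subst this
      simpa using h2
    · nlinarith [mul_pos hs' h1, mul_nonneg ht h2.le]
  have hAc : Convex ℝ A := by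
    rintro _ ⟨v, rfl⟩ _ ⟨w, rfl⟩ s t hs ht hst
    refine ⟨s • v + t • w, ?_⟩
    ext p
    simp only [ContinuousMap.add_apply, ContinuousMap.smul_apply, smul_eq_mul, map_add, map_smul,
      ContinuousMap.const_apply]
    have : s = 1 - t := by linarith
    subst this
    ring
  have hdisj : Disjoint P A := by
    rw [Set.disjoint_left]
    rintro _ hp ⟨v, rfl⟩
    obtain ⟨p, hp'⟩ := hcon v
    have := hp p
    simp only [ContinuousMap.add_apply, ContinuousMap.const_apply] at this
    linarith
  obtain ⟨f, u, hfP, hfA⟩ := geometric_hahn_banach_open hPc hPo hAc hdisj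
  have hcone : ∀ g ∈ P, ∀ r : ℝ, 0 < r → r * f g < u := fun g hg r hr => by
    have := hfP (r • g) fun p => by simpa using mul_pos hr (hg p)
    simpa using this
  have one_mem : (1 : C(G, ℝ)) ∈ P := fun p => by simp
  have hu : 0 ≤ u := by
    by_contra! hneg
    have h1 := hcone 1 one_mem 1 one_pos
    have h2 : f 1 < 0 := by linarith
    have := hcone 1 one_mem (u / (2 * f 1)) (div_pos_of_neg_of_neg hneg (by linarith))
    have h3 : u / (2 * f 1) * f 1 = u / 2 := by
      have := h2.ne
      field_simp
    linarith
  have hfP' : ∀ g ∈ P, f g ≤ 0 := fun g hg => by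
    by_contra! hpos
    have := hcone g hg (u / f g + 1) (by positivity)
    rw [add_mul, div_mul_cancel₀ _ hpos.ne'] at this
    linarith
  have hnonneg : ∀ g : C(G, ℝ), (∀ p, 0 ≤ g p) → f g ≤ 0 := fun g hg => by
    have h1 : ∀ r : ℝ, 0 < r → f g + r * f 1 ≤ 0 := fun r hr => by
      have := hfP' (g + r • 1) fun p => by simpa using add_pos_of_nonneg_of_pos (hg p) hr
      simpa using this
    by_contra! hpos
    have h2 := hfP' 1 one_mem
    have h3 := h1 (f g / (2 * (1 - f 1))) (by apply div_pos hpos; linarith)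
    have h4 : f g / (2 * (1 - f 1)) * (1 - f 1) = f g / 2 := by
      have : 1 - f 1 ≠ 0 := by linarith
      field_simp
    have h5 : 0 < f g / (2 * (1 - f 1)) := by apply div_pos hpos; linarith
    nlinarith
  let Λ : CompactlySupportedContinuousMap G ℝ →ₚ[ℝ] ℝ :=
    { toFun := fun g => -f g.toContinuousMap
      map_add' := fun g g' => by
        have : (g + g').toContinuousMap = g.toContinuousMap + g'.toContinuousMap := rfl
        rw [this, map_add]
        ring
      map_smul' := fun r g => by
        have : (r • g).toContinuousMap = r • g.toContinuousMap := rfl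
        rw [this, map_smul]
        simp
      monotone' := fun g g' hgg' => by
        have := hnonneg (g'.toContinuousMap - g.toContinuousMap) fun p => by
          have := hgg' p
          simpa using this
        rw [map_sub] at this
        show -f g.toContinuousMap ≤ -f g'.toContinuousMap
        linarith }
  have hint : ∀ g : C(G, ℝ), ∫ p, g p ∂(RealRMK.rieszMeasure Λ) = -f g := fun g =>
    RealRMK.integral_rieszMeasure Λ
      ⟨g, HasCompactSupport.of_compactSpace g⟩
  have hL : ∀ v, f (L v) = 0 := fun v => by
    have h1 : ∀ r : ℝ, u ≤ f (q + ContinuousMap.const G δ) + r * f (L v) := fun r => by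
      have := hfA _ ⟨r • v, rfl⟩
      simpa using this
    by_contra hne
    have := h1 ((u - 1 - f (q + ContinuousMap.const G δ)) / f (L v))
    rw [div_mul_cancel₀ _ hne] at this
    linarith
  have hq := H (RealRMK.rieszMeasure Λ) inferInstance fun v => by rw [hint, hL, neg_zero]
  rw [hint] at hq
  have h1 := hfA _ ⟨0, rfl⟩
  have h2 : ContinuousMap.const G δ = δ • (1 : C(G, ℝ)) := by ext; simp
  simp only [map_zero, add_zero, map_add, h2, map_smul, smul_eq_mul] at h1
  have h3 := hfP' 1 one_mem
  have h5 : f 1 = 0 := by nlinarith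
  rw [h5] at h1
  have hu0 : u = 0 ∨ 0 < u := hu.eq_or_lt.imp Eq.symm id
  have h6 : 0 < u := by simpa [h5] using hfP 1 one_mem
  linarith

instance (M : Model n Uc S) : IsProbabilityMeasure M.ν := M.ν_prob

instance (M : Model n Uc S) : CompactSpace M.Y := isCompact_iff_compactSpace.mp M.Y_compact

instance (M : Model n Uc S) : Nonempty M.Y := M.Y_nonempty.to_subtype

theorem isCompact_graphG (M : Model n Uc S) : IsCompact (graphG M) :=
  (M.Y_compact.prod isCompact_univ).of_isClosed_subset M.graph_closed fun _ hp => ⟨hp.1, trivial⟩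

instance (M : Model n Uc S) : CompactSpace (graphG M) :=
  isCompact_iff_compactSpace.mp (isCompact_graphG M)

instance (M : Model n Uc S) : Nonempty (graphG M) := by
  obtain ⟨y, hy⟩ := M.Y_nonempty
  obtain ⟨u, hu⟩ := M.U_nonempty y hy
  exact ⟨⟨(y, u), hy, hu⟩⟩

/-- The state component of a point of the graph. -/
def graphFst (M : Model n Uc S) (p : graphG M) : M.Y := ⟨p.1.1, p.2.1⟩

theorem continuous_graphFst (M : Model n Uc S) : Continuous (graphFst M) :=
  (continuous_fst.comp continuous_subtype_val).subtype_mk _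

theorem surjective_graphFst (M : Model n Uc S) : Function.Surjective (graphFst M) := by
  rintro ⟨y, hy⟩
  obtain ⟨u, hu⟩ := M.U_nonempty y hy
  exact ⟨⟨(y, u), hy, hu⟩, rfl⟩

/-- The transition map of the recursion, as a map into the invariant set. -/
def step (M : Model n Uc S) (p : graphG M) (s : S) : M.Y :=
  ⟨M.f p.1.1 p.1.2 s, M.f_inv _ p.2.1 _ p.2.2 s⟩

theorem continuous_step (M : Model n Uc S) (s : S) : Continuous fun p => step M p s :=
  ((M.f_cont s).comp_continuous continuous_subtype_val fun p => ⟨p.2.1, trivial⟩).subtype_mk _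

theorem measurable_step (M : Model n Uc S) (p : graphG M) : Measurable (step M p) :=
  (M.f_meas _ p.2.1 _).subtype_mk

theorem measurable_uncurry_step (M : Model n Uc S) : Measurable (Function.uncurry (step M)) :=
  measurable_uncurry_of_continuous_of_measurable (continuous_step M) (measurable_step M)

theorem measurable_map_step (M : Model n Uc S) : Measurable fun p => M.ν.map (step M p) := by
  refine Measure.measurable_of_measurable_coe _ fun A hA => ?_
  simp_rw [Measure.map_apply (measurable_step M _) hA]
  exact measurable_measure_prodMk_left (measurable_uncurry_step M hA)

instance (M : Model n Uc S) (p : graphG M) : IsProbabilityMeasure (M.ν.map (step M p)) :=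
  Measure.isProbabilityMeasure_map (measurable_step M p).aemeasurable

/-- The plan obtained by dropping the first decision rule. -/
def Plan.shift {M : Model n Uc S} (π : Plan M) : Plan M where
  π j := π.π (j + 1)
  measurable j := π.measurable (j + 1)
  feasible j := π.feasible (j + 1)

/-- The plan that applies `σ` first and then follows `π`. -/
def Plan.cons {M : Model n Uc S} (σ : (Fin n → ℝ) → Uc) (hσ : Measurable σ)
    (hf : ∀ y ∈ M.Y, σ y ∈ M.U y) (π : Plan M) : Plan M where
  π j := Nat.casesOn j σ π.π
  measurable j := by cases j with
    | zero => exact hσ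
    | succ j => exact π.measurable j
  feasible j := by cases j with
    | zero => exact hf
    | succ j => exact π.feasible j

/-- The state-control pair prescribed by the first decision rule of a plan. -/
def Plan.point {M : Model n Uc S} (π : Plan M) (y : M.Y) : graphG M :=
  ⟨(y, π.π 0 y), y.2, π.feasible 0 y y.2⟩

theorem Plan.measurable_point {M : Model n Uc S} (π : Plan M) : Measurable π.point :=
  (measurable_subtype_coe.prodMk ((π.measurable 0).comp measurable_subtype_coe)).subtype_mk

theorem stateLaw_zero (M : Model n Uc S) (π : ℕ → (Fin n → ℝ) → Uc) (y : Fin n → ℝ) :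
    stateLaw M 0 π y = Measure.dirac y := rfl

theorem stateLaw_succ (M : Model n Uc S) (t : ℕ) (π : Plan M) (y : M.Y)
    (hm : Measurable fun z : M.Y => stateLaw M t π.shift.π z) :
    stateLaw M (t + 1) π.π y =
      (M.ν.map (step M (π.point y))).bind fun z => stateLaw M t π.shift.π z := by
  have he : MeasurableEmbedding (Subtype.val : M.Y → Fin n → ℝ) :=
    MeasurableEmbedding.subtype_coe M.Y_compact.measurableSet
  have h1 : (M.ν.map fun s => M.f y (π.π 0 y) s) =
      (M.ν.map (step M (π.point y))).map Subtype.val := by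
    rw [Measure.map_map measurable_subtype_coe (measurable_step M _)]
    rfl
  change (M.ν.map fun s => M.f y (π.π 0 y) s).bind (stateLaw M t π.shift.π) = _
  rw [h1, Measure.bind, Measure.bind, AEMeasurable.map_map_of_aemeasurable
    (g := stateLaw M t π.shift.π) (he.aemeasurable_map_iff.2 hm.aemeasurable)
    measurable_subtype_coe.aemeasurable]
  rfl

theorem measurable_stateLaw (M : Model n Uc S) (t : ℕ) :
    ∀ π : Plan M, Measurable fun y : M.Y => stateLaw M t π.π y := by
  induction t with
  | zero => exact fun π => Measure.measurable_dirac.comp measurable_subtype_coe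
  | succ t ih =>
    intro π
    simp_rw [stateLaw_succ M t π _ (ih π.shift)]
    exact (Measure.measurable_bind' (ih π.shift)).comp
      ((measurable_map_step M).comp π.measurable_point)

theorem isProbabilityMeasure_stateLaw (M : Model n Uc S) (t : ℕ) :
    ∀ (π : Plan M) (y : M.Y), IsProbabilityMeasure (stateLaw M t π.π y) := by
  induction t with
  | zero => exact fun π y => Measure.dirac.isProbabilityMeasure
  | succ t ih =>
    intro π y
    rw [stateLaw_succ M t π y (measurable_stateLaw M t π.shift)]
    exact isProbabilityMeasure_bind (measurable_stateLaw M t π.shift).aemeasurable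
      (ae_of_all _ fun z => ih π.shift z)

theorem stateLaw_compl (M : Model n Uc S) (t : ℕ) :
    ∀ (π : Plan M) (y : M.Y), stateLaw M t π.π y M.Yᶜ = 0 := by
  have hY : MeasurableSet M.Yᶜ := M.Y_compact.measurableSet.compl
  induction t with
  | zero => exact fun π y => by simp [stateLaw_zero, Measure.dirac_apply' _ hY]
  | succ t ih =>
    intro π y
    rw [stateLaw_succ M t π y (measurable_stateLaw M t π.shift),
      Measure.bind_apply hY (measurable_stateLaw M t π.shift).aemeasurable]
    simp [ih]

theorem expSA_congr (M : Model n Uc S) {k k' : (Fin n → ℝ) → Uc → ℝ}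
    (hkk' : ∀ y ∈ M.Y, ∀ u, k y u = k' y u) (t : ℕ) (π : Plan M) {y : Fin n → ℝ} (hy : y ∈ M.Y) :
    expSA M t π.π y k = expSA M t π.π y k' := by
  refine integral_congr_ae ?_
  have h1 : ∀ᵐ p ∂saLaw M t π.π y, p.1 ∈ M.Y := by
    refine (ae_map_iff (measurable_id.prodMk (π.measurable t)).aemeasurable
      (measurable_fst M.Y_compact.measurableSet)).2 ?_
    exact mem_ae_iff.2 (stateLaw_compl M t π ⟨y, hy⟩)
  filter_upwards [h1] with p hp using hkk' _ hp _

section Cost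

variable (M : Model n Uc S) {k : (Fin n → ℝ) → Uc → ℝ}

theorem expSA_eq (hk : Continuous (Function.uncurry k)) (t : ℕ) (π : Plan M) (y : Fin n → ℝ) :
    expSA M t π.π y k = ∫ z, k z (π.π t z) ∂stateLaw M t π.π y :=
  integral_map (φ := fun z => (z, π.π t z)) (measurable_id.prodMk (π.measurable t)).aemeasurable
    (f := Function.uncurry k) hk.measurable.aestronglyMeasurable

theorem measurable_cost_selection (hk : Continuous (Function.uncurry k)) (t : ℕ) (π : Plan M) :
    Measurable fun z => k z (π.π t z) :=
  hk.measurable.comp (measurable_id.prodMk (π.measurable t))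

theorem measurable_expSA (hk : Continuous (Function.uncurry k)) (t : ℕ) (π : Plan M) :
    Measurable fun y : M.Y => expSA M t π.π y k := by
  simp_rw [expSA_eq M hk]
  let K : ProbabilityTheory.Kernel M.Y (Fin n → ℝ) := ⟨_, measurable_stateLaw M t π⟩
  have : ProbabilityTheory.IsMarkovKernel K := ⟨isProbabilityMeasure_stateLaw M t π⟩
  exact (StronglyMeasurable.integral_kernel (κ := K)
    (measurable_cost_selection M hk t π).stronglyMeasurable).measurable

theorem abs_expSA_le {C : ℝ} (hkC : ∀ y u, |k y u| ≤ C)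
    (hk : Continuous (Function.uncurry k)) (t : ℕ) (π : Plan M) (y : M.Y) :
    |expSA M t π.π y k| ≤ C := by
  have := isProbabilityMeasure_stateLaw M t π y
  rw [expSA_eq M hk]
  have h : ∀ z, ‖k z (π.π t z)‖ ≤ C := fun z => hkC z _
  simpa using norm_integral_le_of_norm_le_const (μ := stateLaw M t π.π y) (ae_of_all _ h)

theorem expSA_zero (hk : Continuous (Function.uncurry k)) (π : Plan M) (y : M.Y) :
    expSA M 0 π.π y k = k y (π.π 0 y) := by
  rw [expSA_eq M hk, stateLaw_zero, integral_dirac]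

theorem expSA_succ {C : ℝ} (hkC : ∀ y u, |k y u| ≤ C) (hk : Continuous (Function.uncurry k))
    (t : ℕ) (π : Plan M) (y : M.Y) :
    expSA M (t + 1) π.π y k = ∫ s, expSA M t π.shift.π (step M (π.point y) s) k ∂M.ν := by
  have h := measurable_stateLaw M t π.shift
  rw [expSA_eq M hk, stateLaw_succ M t π y h, integral_bind_of_bounded h
    (isProbabilityMeasure_stateLaw M t π.shift) (measurable_cost_selection M hk (t + 1) π)
    fun z => hkC z _]
  have h2 := integral_map (μ := M.ν) (measurable_step M (π.point y)).aemeasurable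
    (measurable_expSA M hk t π.shift).aestronglyMeasurable
  simp_rw [← h2, expSA_eq M hk]
  rfl

/-- The discounted cost truncated to the first `N` stages. -/
def costTrunc (k : (Fin n → ℝ) → Uc → ℝ) (ε : ℝ) (N : ℕ) (π : Plan M) (y : Fin n → ℝ) : ℝ :=
  ε * ∑ t ∈ Finset.range N, (1 - ε) ^ t * expSA M t π.π y k

theorem costTrunc_succ {C : ℝ} (hkC : ∀ y u, |k y u| ≤ C) (hk : Continuous (Function.uncurry k))
    (ε : ℝ) (N : ℕ) (π : Plan M) (y : M.Y) :
    costTrunc M k ε (N + 1) π y = ε * k y (π.π 0 y) +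
      (1 - ε) * ∫ s, costTrunc M k ε N π.shift (step M (π.point y) s) ∂M.ν := by
  simp only [costTrunc]
  rw [integral_const_mul, integral_finsetSum, Finset.sum_range_succ', pow_zero, one_mul,
    expSA_zero M hk]
  · simp_rw [expSA_succ M hkC hk, integral_const_mul, pow_succ]
    rw [mul_add, add_comm, mul_left_comm (1 - ε), Finset.mul_sum (a := 1 - ε)]
    congr 3
    funext t
    ring
  · intro t _
    exact (Integrable.of_bound ((measurable_expSA M hk t π.shift).comp
      (measurable_step M _)).aestronglyMeasurable C
      (ae_of_all _ fun s => abs_expSA_le M hkC hk t π.shift _)).const_mul _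

theorem abs_costDisc_sub_costTrunc_le {C : ℝ} (hkC : ∀ y u, |k y u| ≤ C)
    (hk : Continuous (Function.uncurry k)) {ε : ℝ} (hε : ε ∈ Ioo (0 : ℝ) 1) (N : ℕ) (π : Plan M)
    (y : M.Y) : |costDisc M k ε π.π y - costTrunc M k ε N π y| ≤ C * (1 - ε) ^ N := by
  have hb0 : 0 ≤ 1 - ε := by linarith [hε.2]
  have hb1 : 1 - ε < 1 := by linarith [hε.1]
  have hg := (hasSum_geometric_of_lt_one hb0 hb1).mul_left C
  have hbd : ∀ t, ‖(1 - ε) ^ t * expSA M t π.π y k‖ ≤ C * (1 - ε) ^ t := fun t => by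
    rw [norm_mul, norm_pow, Real.norm_of_nonneg hb0, mul_comm]
    exact mul_le_mul_of_nonneg_right (abs_expSA_le M hkC hk t π y) (by positivity)
  have hs : Summable fun t => (1 - ε) ^ t * expSA M t π.π y k :=
    Summable.of_norm_bounded hg.summable hbd
  have h1 : costDisc M k ε π.π y - costTrunc M k ε N π y =
      ε * ∑' t, (1 - ε) ^ (t + N) * expSA M (t + N) π.π y k := by
    rw [costDisc, costTrunc, ← hs.sum_add_tsum_nat_add N]
    ring
  have h2 : ‖∑' t, (1 - ε) ^ (t + N) * expSA M (t + N) π.π y k‖ ≤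
      (1 - ε) ^ N * (C * (1 - (1 - ε))⁻¹) := by
    refine tsum_of_norm_bounded (hg.mul_left ((1 - ε) ^ N)) fun t => (hbd _).trans (le_of_eq ?_)
    ring
  rw [h1, abs_mul, abs_of_pos hε.1]
  refine (mul_le_mul_of_nonneg_left h2 hε.1.le).trans (le_of_eq ?_)
  have := hε.1.ne'
  rw [sub_sub_cancel]
  field_simp

theorem abs_costTrunc_le {C : ℝ} (hkC : ∀ y u, |k y u| ≤ C)
    (hk : Continuous (Function.uncurry k)) {ε : ℝ} (hε : ε ∈ Ioo (0 : ℝ) 1) (N : ℕ) (π : Plan M)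
    (y : M.Y) : |costTrunc M k ε N π y| ≤ C := by
  have hb0 : 0 ≤ 1 - ε := by linarith [hε.2]
  have hC : 0 ≤ C := (abs_nonneg _).trans (abs_expSA_le M hkC hk 0 π y)
  have h1 : |∑ t ∈ Finset.range N, (1 - ε) ^ t * expSA M t π.π y k| ≤
      ∑ t ∈ Finset.range N, (1 - ε) ^ t * C := by
    refine (Finset.abs_sum_le_sum_abs _ _).trans (Finset.sum_le_sum fun t _ => ?_)
    rw [abs_mul, abs_pow, abs_of_nonneg hb0]
    exact mul_le_mul_of_nonneg_left (abs_expSA_le M hkC hk t π y) (by positivity)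
  rw [costTrunc, abs_mul, abs_of_pos hε.1]
  refine (mul_le_mul_of_nonneg_left h1 hε.1.le).trans ?_
  have h2 : ε * ∑ t ∈ Finset.range N, (1 - ε) ^ t = 1 - (1 - ε) ^ N := by
    have := geom_sum_mul (1 - ε) N
    linarith
  rw [← Finset.sum_mul, ← mul_assoc, h2]
  nlinarith [pow_nonneg hb0 N]

theorem measurable_costTrunc (hk : Continuous (Function.uncurry k)) (ε : ℝ) (N : ℕ) (π : Plan M) :
    Measurable fun y : M.Y => costTrunc M k ε N π y :=
  (Finset.measurable_sum _ fun t _ => (measurable_expSA M hk t π).const_mul _).const_mul _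

theorem exists_selector {F : graphG M → ℝ} (hF : LowerSemicontinuous F) :
    ∃ (σ : (Fin n → ℝ) → Uc) (_ : Measurable σ) (hf : ∀ y ∈ M.Y, σ y ∈ M.U y),
      (∀ p : graphG M, F ⟨(p.1.1, σ p.1.1), p.2.1, hf _ p.2.1⟩ ≤ F p) ∧
      LowerSemicontinuous fun y : M.Y => F ⟨(y, σ y), y.2, hf y y.2⟩ := by
  obtain ⟨τ, hτ, hpr, hmin, hlsc⟩ :=
    exists_measurable_fiberwise_argmin (continuous_graphFst M) (surjective_graphFst M) hF
  have he : MeasurableEmbedding (Subtype.val : M.Y → Fin n → ℝ) :=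
    MeasurableEmbedding.subtype_coe M.Y_compact.measurableSet
  have hτ2 : Measurable fun y => (τ y).1.2 :=
    measurable_snd.comp (measurable_subtype_coe.comp hτ)
  obtain ⟨σ, hσ, hστ⟩ := he.exists_measurable_extend hτ2
    fun _ => ⟨(Classical.arbitrary (graphG M)).1.2⟩
  have hfst : ∀ y, (τ y).1.1 = y := fun y => congrArg Subtype.val (hpr y)
  have hστ' : ∀ y : M.Y, σ y = (τ y).1.2 := fun y => congrFun hστ y
  have hf : ∀ y ∈ M.Y, σ y ∈ M.U y := fun y hy => by
    have h1 := (τ ⟨y, hy⟩).2.2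
    rw [hfst] at h1
    exact hστ' ⟨y, hy⟩ ▸ h1
  have hpt : ∀ y : M.Y, (⟨(y, σ y), y.2, hf y y.2⟩ : graphG M) = τ y := fun y =>
    Subtype.ext (Prod.ext (hfst y).symm (hστ' y))
  refine ⟨σ, hσ, hf, fun p => ?_, ?_⟩
  · exact (congrArg F (hpt (graphFst M p))).trans_le (hmin p)
  · simpa only [hpt] using hlsc

/-- `v` is the value function of the discounted problem truncated to `N` stages. -/
structure IsTruncValue (k : (Fin n → ℝ) → Uc → ℝ) (ε : ℝ) (N : ℕ) (v : M.Y → ℝ) : Prop where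
  lsc : LowerSemicontinuous v
  le : ∀ (π : Plan M) (y : M.Y), v y ≤ costTrunc M k ε N π y
  attained : ∃ π : Plan M, ∀ y : M.Y, costTrunc M k ε N π y = v y

theorem nonempty_plan : Nonempty (Plan M) := by
  obtain ⟨σ, hσ, hf, -⟩ := exists_selector M (F := fun _ => 0) lowerSemicontinuous_const
  exact ⟨⟨fun _ => σ, fun _ => hσ, fun _ => hf⟩⟩

theorem isTruncValue_zero (ε : ℝ) : IsTruncValue M k ε 0 fun _ => 0 where
  lsc := lowerSemicontinuous_const
  le π y := by simp [costTrunc]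
  attained := ⟨(nonempty_plan M).some, fun y => by simp [costTrunc]⟩

variable {C ε : ℝ}

theorem IsTruncValue.abs_value_le (hkC : ∀ y u, |k y u| ≤ C) (hk : Continuous (Function.uncurry k))
    (hε : ε ∈ Ioo (0 : ℝ) 1) {N : ℕ} {v : M.Y → ℝ} (hv : IsTruncValue M k ε N v) (y : M.Y) :
    |v y| ≤ C := by
  obtain ⟨π, hπ⟩ := hv.attained
  rw [← hπ]
  exact abs_costTrunc_le M hkC hk hε N π y

theorem integrable_comp_step {φ : M.Y → ℝ} (hφ : Measurable φ) {D : ℝ} (hD : ∀ y, |φ y| ≤ D)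
    (p : graphG M) : Integrable (fun s => φ (step M p s)) M.ν :=
  Integrable.of_bound (hφ.comp (measurable_step M p)).aestronglyMeasurable D
    (ae_of_all _ fun _ => hD _)

theorem IsTruncValue.succ (hkC : ∀ y u, |k y u| ≤ C) (hk : Continuous (Function.uncurry k))
    (hε : ε ∈ Ioo (0 : ℝ) 1) {N : ℕ} {v : M.Y → ℝ} (hv : IsTruncValue M k ε N v) :
    ∃ v' : M.Y → ℝ, IsTruncValue M k ε (N + 1) v' ∧ ∀ p : graphG M,
      v' (graphFst M p) ≤ ε * k p.1.1 p.1.2 + (1 - ε) * ∫ s, v (step M p s) ∂M.ν := by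
  have hb0 : 0 ≤ 1 - ε := by linarith [hε.2]
  have hvC := hv.abs_value_le M hkC hk hε
  let F : graphG M → ℝ := fun p =>
    ε * k p.1.1 p.1.2 + (1 - ε) * ∫ s, v (step M p s) ∂M.ν
  have hF : LowerSemicontinuous F := by
    refine LowerSemicontinuous.add (Continuous.lowerSemicontinuous ?_) ?_
    · exact continuous_const.mul (hk.comp continuous_subtype_val)
    · exact (continuous_const_mul (1 - ε)).comp_lowerSemicontinuous
        (lowerSemicontinuous_integral_comp (continuous_step M) (measurable_step M) hv.lsc hvC)
        fun a b hab => mul_le_mul_of_nonneg_left hab hb0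
  obtain ⟨σ, hσ, hf, hmin, hlsc⟩ := exists_selector M hF
  refine ⟨_, ⟨hlsc, fun π y => ?_, ?_⟩, hmin⟩
  · refine (hmin (π.point y)).trans ?_
    rw [costTrunc_succ M hkC hk]
    refine add_le_add le_rfl (mul_le_mul_of_nonneg_left ?_ hb0)
    exact integral_mono (integrable_comp_step M hv.lsc.measurable hvC _)
      (integrable_comp_step M (measurable_costTrunc M hk ε N π.shift)
        (abs_costTrunc_le M hkC hk hε N π.shift) _) fun s => hv.le _ _
  · obtain ⟨π, hπ⟩ := hv.attained
    refine ⟨Plan.cons σ hσ hf π, fun y => ?_⟩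
    rw [costTrunc_succ M hkC hk]
    exact congrArg (fun x => ε * k y (σ y) + (1 - ε) * x) (integral_congr_ae
      (ae_of_all _ fun s => hπ _))

theorem exists_isTruncValue (hkC : ∀ y u, |k y u| ≤ C) (hk : Continuous (Function.uncurry k))
    (hε : ε ∈ Ioo (0 : ℝ) 1) (N : ℕ) : ∃ v, IsTruncValue M k ε N v := by
  induction N with
  | zero => exact ⟨_, isTruncValue_zero M ε⟩
  | succ N ih =>
    obtain ⟨v, hv⟩ := ih
    obtain ⟨v', hv', -⟩ := hv.succ M hkC hk hε
    exact ⟨v', hv'⟩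

theorem IsTruncValue.abs_hEps_sub_le (hkC : ∀ y u, |k y u| ≤ C)
    (hk : Continuous (Function.uncurry k)) (hε : ε ∈ Ioo (0 : ℝ) 1) {N : ℕ} {v : M.Y → ℝ}
    (hv : IsTruncValue M k ε N v) (y : M.Y) : |hEps M k ε y - v y| ≤ C * (1 - ε) ^ N := by
  have := nonempty_plan M
  have hlow : ∀ π : Plan M, v y - C * (1 - ε) ^ N ≤ costDisc M k ε π.π y := fun π => by
    linarith [(abs_le.1 (abs_costDisc_sub_costTrunc_le M hkC hk hε N π y)).1, hv.le π y]
  obtain ⟨π, hπ⟩ := hv.attained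
  have h1 := ciInf_le ⟨_, forall_mem_range.2 hlow⟩ π
  have h2 := le_ciInf hlow
  have h3 := (abs_le.1 (abs_costDisc_sub_costTrunc_le M hkC hk hε N π y)).2
  rw [hπ] at h3
  rw [abs_le]
  constructor <;> simp only [hEps] <;> linarith

theorem abs_hEps_le (hkC : ∀ y u, |k y u| ≤ C) (hk : Continuous (Function.uncurry k))
    (hε : ε ∈ Ioo (0 : ℝ) 1) (y : M.Y) : |hEps M k ε y| ≤ C := by
  simpa using (isTruncValue_zero M ε).abs_hEps_sub_le M hkC hk hε y

theorem tendsto_const_mul_pow_one_sub (C : ℝ) (hε : ε ∈ Ioo (0 : ℝ) 1) :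
    Tendsto (fun N : ℕ => C * (1 - ε) ^ N) atTop (𝓝 0) := by
  simpa using (tendsto_pow_atTop_nhds_zero_of_lt_one (by linarith [hε.2])
    (by linarith [hε.1])).const_mul C

theorem measurable_hEps (hkC : ∀ y u, |k y u| ≤ C) (hk : Continuous (Function.uncurry k))
    (hε : ε ∈ Ioo (0 : ℝ) 1) : Measurable fun y : M.Y => hEps M k ε y := by
  choose v hv using exists_isTruncValue M hkC hk hε
  refine measurable_of_tendsto_metrizable (fun N => (hv N).lsc.measurable)
    (tendsto_pi_nhds.2 fun y => ?_)
  rw [tendsto_iff_norm_sub_tendsto_zero]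
  refine squeeze_zero (fun N => norm_nonneg _) (fun N => ?_) (tendsto_const_mul_pow_one_sub C hε)
  rw [norm_sub_rev]
  exact (hv N).abs_hEps_sub_le M hkC hk hε y

/-- The dynamic programming inequality for the discounted value function. -/
theorem hEps_le (hkC : ∀ y u, |k y u| ≤ C) (hk : Continuous (Function.uncurry k))
    (hε : ε ∈ Ioo (0 : ℝ) 1) (p : graphG M) : hEps M k ε p.1.1 ≤
      ε * k p.1.1 p.1.2 + (1 - ε) * ∫ s, hEps M k ε (step M p s) ∂M.ν := by
  have hb0 : 0 ≤ 1 - ε := by linarith [hε.2]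
  have key : ∀ N : ℕ, hEps M k ε p.1.1 ≤ ε * k p.1.1 p.1.2 +
      (1 - ε) * ∫ s, hEps M k ε (step M p s) ∂M.ν + 2 * C * (1 - ε) ^ (N + 1) := by
    intro N
    obtain ⟨v, hv⟩ := exists_isTruncValue M hkC hk hε N
    obtain ⟨v', hv', hvv'⟩ := hv.succ M hkC hk hε
    have h1 := (abs_le.1 (hv'.abs_hEps_sub_le M hkC hk hε (graphFst M p))).2
    have h2 : ∫ s, v (step M p s) ∂M.ν ≤
        ∫ s, (hEps M k ε (step M p s) + C * (1 - ε) ^ N) ∂M.ν := by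
      have hi := integrable_comp_step M (measurable_hEps M hkC hk hε) (abs_hEps_le M hkC hk hε) p
      refine integral_mono (integrable_comp_step M hv.lsc.measurable (hv.abs_value_le M hkC hk hε) p)
        (hi.add (integrable_const _)) fun s => ?_
      linarith [(abs_le.1 (hv.abs_hEps_sub_le M hkC hk hε (step M p s))).1]
    rw [integral_add (integrable_comp_step M (measurable_hEps M hkC hk hε)
      (abs_hEps_le M hkC hk hε) p) (integrable_const _)] at h2
    simp only [integral_const, probReal_univ, one_smul] at h2
    have h3 := hvv' p
    have h4 := mul_le_mul_of_nonneg_left h2 hb0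
    have h5 : (graphFst M p : Fin n → ℝ) = p.1.1 := rfl
    rw [h5] at h1
    rw [pow_succ] at h1 ⊢
    linarith
  have hlim := ((tendsto_add_atTop_iff_nat 1).2
    (tendsto_const_mul_pow_one_sub (2 * C) hε)).const_add
      (ε * k p.1.1 p.1.2 + (1 - ε) * ∫ s, hEps M k ε (step M p s) ∂M.ν)
  rw [add_zero] at hlim
  exact ge_of_tendsto' hlim key

/-- Bounded measurable subsolutions of the dynamic programming equation lie below the discounted
value function. -/
theorem le_hEps_of_subsolution (hkC : ∀ y u, |k y u| ≤ C) (hk : Continuous (Function.uncurry k))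
    (hε : ε ∈ Ioo (0 : ℝ) 1) {φ : M.Y → ℝ} (hφ : Measurable φ) {D : ℝ} (hD : ∀ y, |φ y| ≤ D)
    (hsub : ∀ p : graphG M, φ (graphFst M p) ≤
      ε * k p.1.1 p.1.2 + (1 - ε) * ∫ s, φ (step M p s) ∂M.ν) (y : M.Y) :
    φ y ≤ hEps M k ε y := by
  have hb0 : 0 ≤ 1 - ε := by linarith [hε.2]
  have := nonempty_plan M
  have key : ∀ N : ℕ, ∀ (π : Plan M) (y : M.Y),
      φ y ≤ costTrunc M k ε N π y + D * (1 - ε) ^ N := by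
    intro N
    induction N with
    | zero => exact fun π y => by simpa [costTrunc] using (abs_le.1 (hD y)).2
    | succ N ih =>
      intro π y
      have hi := integrable_comp_step M (measurable_costTrunc M hk ε N π.shift)
        (abs_costTrunc_le M hkC hk hε N π.shift) (π.point y)
      have h1 : ∫ s, φ (step M (π.point y) s) ∂M.ν ≤
          ∫ s, (costTrunc M k ε N π.shift (step M (π.point y) s) + D * (1 - ε) ^ N) ∂M.ν :=
        integral_mono (integrable_comp_step M hφ hD _) (hi.add (integrable_const _))
          fun s => ih _ _
      rw [integral_add hi (integrable_const _)] at h1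
      simp only [integral_const, probReal_univ, one_smul] at h1
      have h2 := mul_le_mul_of_nonneg_left h1 hb0
      have h3 : φ y ≤ ε * k y (π.π 0 y) + (1 - ε) * ∫ s, φ (step M (π.point y) s) ∂M.ν :=
        hsub (π.point y)
      rw [costTrunc_succ M hkC hk, pow_succ]
      linarith
  refine le_ciInf fun π => ?_
  have hlim := (tendsto_const_mul_pow_one_sub (C + D) hε).const_add (costDisc M k ε π.π y)
  rw [add_zero] at hlim
  refine ge_of_tendsto' hlim fun N => ?_
  linarith [key N π y, (abs_le.1 (abs_costDisc_sub_costTrunc_le M hkC hk hε N π y)).2,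
    (abs_le.1 (abs_costDisc_sub_costTrunc_le M hkC hk hε N π y)).1]

theorem abs_integral_step_le {φ : M.Y → ℝ} {D : ℝ} (hD : ∀ y, |φ y| ≤ D) (p : graphG M) :
    |∫ s, φ (step M p s) ∂M.ν| ≤ D := by
  have h : ∀ s, ‖φ (step M p s)‖ ≤ D := fun s => hD _
  simpa using norm_integral_le_of_norm_le_const (μ := M.ν) (ae_of_all _ h)

theorem continuous_integral_step {φ : M.Y → ℝ} (hφ : Continuous φ) :
    Continuous fun p => ∫ s, φ (step M p s) ∂M.ν := by
  obtain ⟨D, hD⟩ := (isCompact_range hφ).isBounded.exists_norm_le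
  refine continuous_of_dominated
    (fun p => (hφ.measurable.comp (measurable_step M p)).aestronglyMeasurable)
    (fun p => ae_of_all _ fun s => hD _ (mem_range_self _)) (integrable_const D)
    (ae_of_all _ fun s => hφ.comp (continuous_step M s))

/-- The generator of the controlled recursion, `η ↦ E[η(f(y, u, s))] - η(y)`. -/
def generator : C(M.Y, ℝ) →ₗ[ℝ] C(graphG M, ℝ) where
  toFun η := ⟨fun p => ∫ s, η (step M p s) ∂M.ν - η (graphFst M p),
    (continuous_integral_step M η.continuous).sub (η.continuous.comp (continuous_graphFst M))⟩
  map_add' η θ := by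
    obtain ⟨D, hD⟩ := (isCompact_range η.continuous).isBounded.exists_norm_le
    obtain ⟨D', hD'⟩ := (isCompact_range θ.continuous).isBounded.exists_norm_le
    ext p
    have h := integral_add
      (integrable_comp_step M η.continuous.measurable (fun y => hD _ (mem_range_self y)) p)
      (integrable_comp_step M θ.continuous.measurable (fun y => hD' _ (mem_range_self y)) p)
    simp only [ContinuousMap.coe_mk, ContinuousMap.add_apply, h]
    ring
  map_smul' c η := by
    ext p
    simp only [ContinuousMap.coe_mk, ContinuousMap.smul_apply, smul_eq_mul, integral_const_mul,
      RingHom.id_apply]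
    ring

theorem generator_apply (η : C(M.Y, ℝ)) (p : graphG M) :
    generator M η p = ∫ s, η (step M p s) ∂M.ν - η (graphFst M p) := rfl

theorem integral_step_eq_of_integral_generator_eq_zero (m : Measure (graphG M))
    [IsFiniteMeasure m] (hm : ∀ η, ∫ p, generator M η p ∂m = 0) {φ : M.Y → ℝ} (hφ : Measurable φ)
    {D : ℝ} (hD : ∀ y, |φ y| ≤ D) :
    ∫ p, ∫ s, φ (step M p s) ∂M.ν ∂m = ∫ p, φ (graphFst M p) ∂m := by
  have hst := measurable_uncurry_step M
  have hfs := (continuous_graphFst M).measurable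
  have hprod : ∀ {θ : M.Y → ℝ}, Measurable θ → ∀ {D : ℝ}, (∀ y, |θ y| ≤ D) →
      ∫ y, θ y ∂(m.prod M.ν).map (Function.uncurry (step M)) =
        ∫ p, ∫ s, θ (step M p s) ∂M.ν ∂m := fun hθ D hD => by
    rw [integral_map hst.aemeasurable hθ.aestronglyMeasurable, integral_prod]
    · rfl
    · exact Integrable.of_bound (hθ.comp hst).aestronglyMeasurable D (ae_of_all _ fun _ => hD _)
  have heq : (m.prod M.ν).map (Function.uncurry (step M)) = m.map (graphFst M) := by
    refine ext_of_forall_integral_eq_of_IsFiniteMeasure fun η => ?_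
    rw [hprod η.continuous.measurable η.norm_coe_le_norm,
      integral_map hfs.aemeasurable η.continuous.measurable.aestronglyMeasurable]
    have h1 := hm η.toContinuousMap
    simp only [generator_apply] at h1
    rw [integral_sub] at h1
    · exact sub_eq_zero.1 h1
    · exact (continuous_integral_step M η.continuous).integrable_of_hasCompactSupport
        (HasCompactSupport.of_compactSpace _)
    · exact (η.continuous.comp (continuous_graphFst M)).integrable_of_hasCompactSupport
        (HasCompactSupport.of_compactSpace _)
  rw [← hprod hφ hD, heq, integral_map hfs.aemeasurable hφ.aestronglyMeasurable]

theorem integral_hEps_le (hkC : ∀ y u, |k y u| ≤ C) (hk : Continuous (Function.uncurry k))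
    (hε : ε ∈ Ioo (0 : ℝ) 1) (m : Measure (graphG M)) [IsFiniteMeasure m]
    (hm : ∀ η, ∫ p, generator M η p ∂m = 0) :
    ∫ p, hEps M k ε (graphFst M p) ∂m ≤ ∫ p, k p.1.1 p.1.2 ∂m := by
  have hv := measurable_hEps M hkC hk hε
  have hb := abs_hEps_le M hkC hk hε
  have h1 : Integrable (fun p : graphG M => k p.1.1 p.1.2) m :=
    (hk.comp continuous_subtype_val).integrable_of_hasCompactSupport
      (HasCompactSupport.of_compactSpace _)
  have h2 : Integrable (fun p => ∫ s, hEps M k ε (step M p s) ∂M.ν) m := by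
    have h := (hv.comp (measurable_uncurry_step M)).stronglyMeasurable.integral_prod_right'
      (ν := M.ν)
    exact Integrable.of_bound h.aestronglyMeasurable C
      (ae_of_all _ fun p => abs_integral_step_le M hb p)
  have h3 : Integrable (fun p => hEps M k ε (graphFst M p)) m :=
    Integrable.of_bound (hv.comp (continuous_graphFst M).measurable).aestronglyMeasurable C
      (ae_of_all _ fun p => hb _)
  have h4 := integral_mono h3 ((h1.const_mul ε).add (h2.const_mul (1 - ε)))
    fun p => hEps_le M hkC hk hε p
  simp only [Pi.add_apply] at h4
  rw [integral_add (h1.const_mul ε) (h2.const_mul (1 - ε)), integral_const_mul,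
    integral_const_mul, integral_step_eq_of_integral_generator_eq_zero M m hm hv hb] at h4
  refine le_of_mul_le_mul_left ?_ hε.1
  linarith

section Limit

variable {h : M.Y → ℝ} {e : ℕ → ℝ}

theorem abs_le_of_tendsto_hEps (hkC : ∀ y u, |k y u| ≤ C) (hk : Continuous (Function.uncurry k))
    (he : ∀ i, e i ∈ Ioo (0 : ℝ) 1)
    (hlim : ∀ y : M.Y, Tendsto (fun i => hEps M k (e i) y) atTop (𝓝 (h y))) (y : M.Y) :
    |h y| ≤ C :=
  le_of_tendsto' (hlim y).abs fun i => abs_hEps_le M hkC hk (he i) y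

theorem le_integral_step_of_tendsto_hEps (hkC : ∀ y u, |k y u| ≤ C)
    (hk : Continuous (Function.uncurry k)) (he : ∀ i, e i ∈ Ioo (0 : ℝ) 1)
    (he0 : Tendsto e atTop (𝓝 0))
    (hlim : ∀ y : M.Y, Tendsto (fun i => hEps M k (e i) y) atTop (𝓝 (h y))) (p : graphG M) :
    h (graphFst M p) ≤ ∫ s, h (step M p s) ∂M.ν := by
  have h1 : Tendsto (fun i => ∫ s, hEps M k (e i) (step M p s) ∂M.ν) atTop
      (𝓝 (∫ s, h (step M p s) ∂M.ν)) :=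
    tendsto_integral_of_dominated_convergence (fun _ => C)
      (fun i => ((measurable_hEps M hkC hk (he i)).comp
        (measurable_step M p)).aestronglyMeasurable) (integrable_const C)
      (fun i => ae_of_all _ fun s => abs_hEps_le M hkC hk (he i) _)
      (ae_of_all _ fun s => hlim _)
  have h2 := (he0.mul_const (k p.1.1 p.1.2)).add ((he0.const_sub 1).mul h1)
  rw [zero_mul, zero_add, sub_zero, one_mul] at h2
  exact le_of_tendsto_of_tendsto' (hlim (graphFst M p)) h2 fun i => hEps_le M hkC hk (he i) p

theorem exists_generator_of_tendsto_hEps (hkC : ∀ y u, |k y u| ≤ C)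
    (hk : Continuous (Function.uncurry k)) (he : ∀ i, e i ∈ Ioo (0 : ℝ) 1)
    (hlim : ∀ y : M.Y, Tendsto (fun i => hEps M k (e i) y) atTop (𝓝 (h y)))
    (hh : Continuous h) {δ : ℝ} (hδ : 0 < δ) :
    ∃ η : C(M.Y, ℝ), ∀ p : graphG M,
      -δ < k p.1.1 p.1.2 - h (graphFst M p) + generator M η p := by
  have hkG : Continuous fun p : graphG M => k p.1.1 p.1.2 := hk.comp continuous_subtype_val
  have hhG := hh.comp (continuous_graphFst M)
  refine exists_forall_neg_lt_add ⟨_, hkG.sub hhG⟩ (generator M) hδ fun m _ hm => ?_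
  have h1 : Tendsto (fun i => ∫ p, hEps M k (e i) (graphFst M p) ∂m) atTop
      (𝓝 (∫ p, h (graphFst M p) ∂m)) :=
    tendsto_integral_of_dominated_convergence (fun _ => C)
      (fun i => ((measurable_hEps M hkC hk (he i)).comp
        (continuous_graphFst M).measurable).aestronglyMeasurable) (integrable_const C)
      (fun i => ae_of_all _ fun p => abs_hEps_le M hkC hk (he i) _)
      (ae_of_all _ fun p => hlim _)
  have h2 := le_of_tendsto' h1 fun i => integral_hEps_le M hkC hk (he i) m hm
  have h3 := integral_sub
    (hkG.integrable_of_hasCompactSupport (μ := m) (HasCompactSupport.of_compactSpace _))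
    (hhG.integrable_of_hasCompactSupport (μ := m) (HasCompactSupport.of_compactSpace _))
  refine le_trans ?_ h3.ge
  exact sub_nonneg.2 h2

theorem exists_dualFeas_of_tendsto_hEps (hkC : ∀ y u, |k y u| ≤ C)
    (hk : Continuous (Function.uncurry k)) (he : ∀ i, e i ∈ Ioo (0 : ℝ) 1)
    (he0 : Tendsto e atTop (𝓝 0))
    (hlim : ∀ y : M.Y, Tendsto (fun i => hEps M k (e i) y) atTop (𝓝 (h y)))
    (hh : Continuous h) {δ : ℝ} (hδ : 0 < δ) (y0 : M.Y) :
    ∃ ψ η : (Fin n → ℝ) → ℝ, Continuous ψ ∧ Continuous η ∧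
      DualFeas M k y0 ψ η (h y0 - δ) := by
  obtain ⟨η, hη⟩ := exists_generator_of_tendsto_hEps M hkC hk he hlim hh hδ
  obtain ⟨η', hη'⟩ := ContinuousMap.exists_restrict_eq M.Y_compact.isClosed η
  obtain ⟨ψ, hψ⟩ := ContinuousMap.exists_restrict_eq M.Y_compact.isClosed ⟨h, hh⟩
  have hη'' : ∀ y : M.Y, η' y = η y := fun y => DFunLike.congr_fun hη' y
  have hψ' : ∀ y : M.Y, ψ y = h y := fun y => DFunLike.congr_fun hψ y
  refine ⟨ψ, η', ψ.continuous, η'.continuous, fun p hp => ?_, fun p hp => ?_⟩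
  · have h1 := hη ⟨p, hp⟩
    have h2 : Ef M η' p.1 p.2 = ∫ s, η (step M ⟨p, hp⟩ s) ∂M.ν :=
      integral_congr_ae (ae_of_all _ fun s => hη'' (step M ⟨p, hp⟩ s))
    have h3 : η' p.1 = η (graphFst M ⟨p, hp⟩) := hη'' (graphFst M ⟨p, hp⟩)
    have h4 : ψ p.1 = h (graphFst M ⟨p, hp⟩) := hψ' (graphFst M ⟨p, hp⟩)
    rw [generator_apply] at h1
    rw [h2, h3, h4, hψ']
    linarith
  · have h2 : Ef M ψ p.1 p.2 = ∫ s, h (step M ⟨p, hp⟩ s) ∂M.ν :=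
      integral_congr_ae (ae_of_all _ fun s => hψ' (step M ⟨p, hp⟩ s))
    have h4 : ψ p.1 = h (graphFst M ⟨p, hp⟩) := hψ' (graphFst M ⟨p, hp⟩)
    rw [h2, h4]
    exact sub_nonneg.2 (le_integral_step_of_tendsto_hEps M hkC hk he he0 hlim _)

theorem exists_forall_sub_mul_le_hEps (hkC : ∀ y u, |k y u| ≤ C)
    (hk : Continuous (Function.uncurry k)) {y0 : M.Y} {ψ η : (Fin n → ℝ) → ℝ} {μ : ℝ}
    (hψ : Continuous ψ) (hη : Continuous η) (hf : DualFeas M k y0 ψ η μ) :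
    ∃ B : ℝ, ∀ ε ∈ Ioo (0 : ℝ) 1, μ - ε * B ≤ hEps M k ε y0 := by
  have hψY : Continuous fun y : M.Y => ψ y := hψ.comp continuous_subtype_val
  have hηY : Continuous fun y : M.Y => η y := hη.comp continuous_subtype_val
  obtain ⟨A, hA⟩ := (isCompact_range hψY).isBounded.exists_norm_le
  obtain ⟨B, hB⟩ := (isCompact_range hηY).isBounded.exists_norm_le
  replace hA : ∀ y : M.Y, |ψ y| ≤ A := fun y => hA _ (mem_range_self y)
  replace hB : ∀ y : M.Y, |η y| ≤ B := fun y => hB _ (mem_range_self y)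
  refine ⟨2 * B, fun ε hε => ?_⟩
  let φ : M.Y → ℝ := fun y => μ - ψ y0 - ε * B + (ψ y + ε * η y)
  have hφ : Continuous φ := by fun_prop
  obtain ⟨D, hD⟩ := (isCompact_range hφ).isBounded.exists_norm_le
  have key := le_hEps_of_subsolution M hkC hk hε hφ.measurable
    (fun y => hD _ (mem_range_self y)) (fun p => ?_) y0
  · simp only [φ] at key
    nlinarith [(abs_le.1 (hB y0)).1, hε.1]
  have hiψ := integrable_comp_step M hψY.measurable hA p
  have hiη := integrable_comp_step M hηY.measurable hB p
  have h1 : ∫ s, φ (step M p s) ∂M.ν =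
      μ - ψ y0 - ε * B + (Ef M ψ p.1.1 p.1.2 + ε * Ef M η p.1.1 p.1.2) := by
    simp only [φ]
    have hi : Integrable (fun s => ψ (step M p s) + ε * η (step M p s)) M.ν :=
      hiψ.add (hiη.const_mul ε)
    rw [integral_add (integrable_const _) hi, integral_add hiψ (hiη.const_mul ε),
      integral_const_mul]
    simp [Ef, step]
  have h2 := hf.1 p p.2
  have h3 := hf.2 p p.2
  have h4 : |Ef M η p.1.1 p.1.2| ≤ B := abs_integral_step_le M hB p
  have h5 := (abs_le.1 h4).2
  have h6 : (graphFst M p : Fin n → ℝ) = p.1.1 := rfl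
  rw [h1]
  simp only [φ, h6]
  have h7 := mul_nonneg hε.1.le h2
  have h8 := mul_nonneg (sub_nonneg.2 hε.2.le) h3
  have h9 := mul_nonneg (mul_nonneg hε.1.le hε.1.le) (sub_nonneg.2 h5)
  linarith

theorem eq_dStar_of_tendsto_hEps (hkC : ∀ y u, |k y u| ≤ C)
    (hk : Continuous (Function.uncurry k)) (he : ∀ i, e i ∈ Ioo (0 : ℝ) 1)
    (he0 : Tendsto e atTop (𝓝 0))
    (hlim : ∀ y : M.Y, Tendsto (fun i => hEps M k (e i) y) atTop (𝓝 (h y)))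
    (hh : Continuous h) (y0 : M.Y) : h y0 = dStar M k y0 := by
  symm
  refine csSup_eq_of_forall_le_of_forall_lt_exists_gt
    ⟨h y0 - 1, exists_dualFeas_of_tendsto_hEps M hkC hk he he0 hlim hh one_pos y0⟩ ?_ ?_
  · rintro μ ⟨ψ, η, hψ, hη, hf⟩
    obtain ⟨B, hB⟩ := exists_forall_sub_mul_le_hEps M hkC hk hψ hη hf
    have h1 := (he0.mul_const B).const_sub μ
    rw [zero_mul, sub_zero] at h1
    exact le_of_tendsto_of_tendsto' h1 (hlim y0) fun i => hB _ (he i)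
  · intro w hw
    refine ⟨_, exists_dualFeas_of_tendsto_hEps M hkC hk he he0 hlim hh
      (half_pos (sub_pos.2 hw)) y0, ?_⟩
    linarith

end Limit

end Cost

theorem hEps_congr (M : Model n Uc S) {k k' : (Fin n → ℝ) → Uc → ℝ}
    (hkk' : ∀ y ∈ M.Y, ∀ u, k y u = k' y u) (ε : ℝ) {y : Fin n → ℝ} (hy : y ∈ M.Y) :
    hEps M k ε y = hEps M k' ε y := by
  simp only [hEps, costDisc, expSA_congr M hkk' _ _ hy]

theorem dStar_congr (M : Model n Uc S) {k k' : (Fin n → ℝ) → Uc → ℝ}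
    (hkk' : ∀ y ∈ M.Y, ∀ u, k y u = k' y u) (y : Fin n → ℝ) : dStar M k y = dStar M k' y := by
  have h : ∀ ψ η μ, DualFeas M k y ψ η μ ↔ DualFeas M k' y ψ η μ := fun ψ η μ =>
    and_congr (forall₂_congr fun p hp => by rw [hkk' p.1 hp.1]) Iff.rfl
  simp only [dStar, h]

/-- A cost that is continuous and bounded on `Y × Uc` extends to a bounded continuous cost. -/
theorem exists_continuous_cost_extension (M : Model n Uc S) {k : (Fin n → ℝ) → Uc → ℝ}
    (hk : ContinuousOn (fun p : (Fin n → ℝ) × Uc => k p.1 p.2) (M.Y ×ˢ (univ : Set Uc)))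
    {C : ℝ} (hkC : ∀ y ∈ M.Y, ∀ u : Uc, |k y u| ≤ C) :
    ∃ k' : (Fin n → ℝ) → Uc → ℝ, Continuous (Function.uncurry k') ∧ (∀ y u, |k' y u| ≤ C) ∧
      ∀ y ∈ M.Y, ∀ u, k y u = k' y u := by
  have hC : 0 ≤ C := by
    obtain ⟨p⟩ : Nonempty (graphG M) := inferInstance
    exact (abs_nonneg _).trans (hkC _ p.2.1 p.1.2)
  obtain ⟨g, hgC, hg⟩ := ContinuousMap.exists_restrict_eq_forall_mem_of_closed
    (s := M.Y ×ˢ (univ : Set Uc)) ⟨_, hk.domRestrict⟩ (t := Icc (-C) C)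
    (fun p => abs_le.1 (hkC _ p.2.1 _)) (nonempty_Icc.2 (by linarith))
    (M.Y_compact.isClosed.prod isClosed_univ)
  exact ⟨fun y u => g (y, u), g.continuous, fun y u => abs_le.2 (hgC _), fun y hy u =>
    (DFunLike.congr_fun hg ⟨(y, u), hy, trivial⟩).symm⟩

/-- if `h_ε` converges pointwise on `Y` (as `ε → 0`) to a continuous
function `h`, then `h(y₀) = d*(y₀)` for every `y₀ ∈ Y`. -/
theorem statement11 (M : Model n Uc S) (k : (Fin n → ℝ) → Uc → ℝ)
    (hk : ContinuousOn (fun p : (Fin n → ℝ) × Uc => k p.1 p.2) (M.Y ×ˢ (univ : Set Uc)))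
    (C : ℝ) (hkC : ∀ y ∈ M.Y, ∀ u : Uc, |k y u| ≤ C)
    (h : (Fin n → ℝ) → ℝ)
    (hconv : ∀ y ∈ M.Y,
      Tendsto (fun ε : ℝ => hEps M k ε y) (𝓝[Set.Ioo (0 : ℝ) 1] 0) (𝓝 (h y)))
    (hhcont : ContinuousOn h M.Y) :
    ∀ y0 ∈ M.Y, h y0 = dStar M k y0 := by
  intro y0 hy0
  obtain ⟨k', hk', hk'C, hkk'⟩ := exists_continuous_cost_extension M hk hkC
  obtain ⟨e, -, he, he0⟩ := exists_seq_strictAnti_tendsto' (zero_lt_one (α := ℝ))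
  have he1 : Tendsto e atTop (𝓝[Ioo (0 : ℝ) 1] 0) :=
    tendsto_nhdsWithin_iff.2 ⟨he0, Eventually.of_forall he⟩
  rw [dStar_congr M hkk']
  refine eq_dStar_of_tendsto_hEps M (h := fun y => h y) hk'C hk' he he0 (fun y => ?_)
    hhcont.domRestrict ⟨y0, hy0⟩
  simpa only [hEps_congr M hkk' _ y.2, Function.comp_def] using (hconv y y.2).comp he1

end StochLP
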